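/- (Euclidean distance to planar rotations.) Let F ∈ GL⁺(2). Then min_{R ∈ SO(2)} ‖RᵀF − 𝟙‖² = ‖U(F) − 𝟙‖² = ‖F‖² − 2·√(‖F‖² + 2·det F) + 2. -/

import Mathlib

open Matrix Real

noncomputable section

/-- Squared Frobenius norm: `‖X‖² = tr (Xᵀ X)`. -/
def frobSq {n : ℕ} (X : Matrix (Fin n) (Fin n) ℝ) : ℝ := Matrix.trace (Xᵀ * X)

/-- The special orthogonal group as a set of matrices. -/
def SO (n : ℕ) : Set (Matrix (Fin n) (Fin n) ℝ) := {R | Rᵀ * R = 1 ∧ R.det = 1}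

/-- Symmetric part of a matrix. -/
def symPart {n : ℕ} (X : Matrix (Fin n) (Fin n) ℝ) : Matrix (Fin n) (Fin n) ℝ :=
  (1 / 2 : ℝ) • (X + Xᵀ)

/-- Skew-symmetric part of a matrix. -/
def skewPart {n : ℕ} (X : Matrix (Fin n) (Fin n) ℝ) : Matrix (Fin n) (Fin n) ℝ :=
  (1 / 2 : ℝ) • (X - Xᵀ)

/-- The Cosserat shear-stretch energy `W_{μ,μc}(R; F)`. -/
def W (μ μc : ℝ) {n : ℕ} (R F : Matrix (Fin n) (Fin n) ℝ) : ℝ :=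
  μ * frobSq (symPart (Rᵀ * F - 1)) + μc * frobSq (skewPart (Rᵀ * F - 1))

/-- The planar rotation by angle `α`. -/
def rot (α : ℝ) : Matrix (Fin 2) (Fin 2) ℝ :=
  !![Real.cos α, -Real.sin α; Real.sin α, Real.cos α]

theorem frobSq_fin_two (X : Matrix (Fin 2) (Fin 2) ℝ) :
    frobSq X = X 0 0 ^ 2 + X 0 1 ^ 2 + X 1 0 ^ 2 + X 1 1 ^ 2 := by
  simp [frobSq, Matrix.trace_fin_two, Matrix.mul_apply, Fin.sum_univ_two]
  ring

theorem frobSq_add_two_mul_det (F : Matrix (Fin 2) (Fin 2) ℝ) :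
    frobSq F + 2 * F.det = (F 0 0 + F 1 1) ^ 2 + (F 1 0 - F 0 1) ^ 2 := by
  rw [frobSq_fin_two, Matrix.det_fin_two]
  ring

/-- Matrices in `SO 2` have the form `!![x, -y; y, x]` with `x ^ 2 + y ^ 2 = 1`. -/
theorem mem_SO_two_iff (R : Matrix (Fin 2) (Fin 2) ℝ) :
    R ∈ SO 2 ↔ R 1 1 = R 0 0 ∧ R 0 1 = -R 1 0 ∧ R 0 0 ^ 2 + R 1 0 ^ 2 = 1 := by
  simp only [SO, Set.mem_ofPred_eq, ← Matrix.ext_iff, Fin.forall_fin_two, Matrix.mul_apply,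
    Fin.sum_univ_two, Matrix.transpose_apply, Matrix.one_apply, Matrix.det_fin_two]
  norm_num
  constructor
  · rintro ⟨⟨⟨h1, -⟩, -, h2⟩, h3⟩
    have hs : (R 1 1 - R 0 0) ^ 2 + (R 0 1 + R 1 0) ^ 2 = 0 := by linarith
    refine ⟨?_, ?_, by linarith⟩
    · nlinarith [sq_nonneg (R 1 1 - R 0 0), sq_nonneg (R 0 1 + R 1 0)]
    · nlinarith [sq_nonneg (R 1 1 - R 0 0), sq_nonneg (R 0 1 + R 1 0)]
  · rintro ⟨h1, h2, h3⟩
    rw [h1, h2]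
    refine ⟨⟨⟨?_, ?_⟩, ?_, ?_⟩, ?_⟩ <;> linarith

theorem frobSq_transpose_mul_sub_one {R : Matrix (Fin 2) (Fin 2) ℝ} (hR : R ∈ SO 2)
    (F : Matrix (Fin 2) (Fin 2) ℝ) :
    frobSq (Rᵀ * F - 1) =
      frobSq F - 2 * (R 0 0 * (F 0 0 + F 1 1) + R 1 0 * (F 1 0 - F 0 1)) + 2 := by
  obtain ⟨h1, h2, h3⟩ := (mem_SO_two_iff R).1 hR
  simp only [frobSq_fin_two, Matrix.sub_apply, Matrix.mul_apply, Fin.sum_univ_two,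
    Matrix.transpose_apply, Matrix.one_apply, h1, h2]
  norm_num
  linear_combination (F 0 0 ^ 2 + F 0 1 ^ 2 + F 1 0 ^ 2 + F 1 1 ^ 2) * h3

/-- The trace of the stretch tensor `U = √(Fᵀ F)` in the plane. -/
theorem trace_eq_sqrt_of_mul_self_eq {F U : Matrix (Fin 2) (Fin 2) ℝ} (hF : 0 < F.det)
    (hUpos : U.PosDef) (hUsq : U * U = Fᵀ * F) :
    U.trace = Real.sqrt (frobSq F + 2 * F.det) := by
  have hdet : U.det = F.det := by
    have h := congrArg Matrix.det hUsq
    rw [Matrix.det_mul, Matrix.det_mul, Matrix.det_transpose] at h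
    exact (mul_self_inj hUpos.det_pos.le hF.le).1 h
  have hsq : U.trace ^ 2 = frobSq F + 2 * F.det := by
    rw [frobSq, ← hUsq, ← hdet]
    simp only [Matrix.trace_fin_two, Matrix.det_fin_two, Matrix.mul_apply, Fin.sum_univ_two]
    ring
  rw [← hsq, Real.sqrt_sq hUpos.trace_pos.le]

theorem frobSq_sub_one_of_mul_self_eq {F U : Matrix (Fin 2) (Fin 2) ℝ} (hF : 0 < F.det)
    (hUpos : U.PosDef) (hUsq : U * U = Fᵀ * F) :
    frobSq (U - 1) = frobSq F - 2 * Real.sqrt (frobSq F + 2 * F.det) + 2 := by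
  have hT : Uᵀ = U := by simpa using hUpos.isHermitian.eq
  rw [← trace_eq_sqrt_of_mul_self_eq hF hUpos hUsq]
  have h : (U - 1)ᵀ * (U - 1) = Fᵀ * F - U - U + 1 := by
    rw [Matrix.transpose_sub, hT, Matrix.transpose_one, ← hUsq]
    noncomm_ring
  rw [frobSq, frobSq, h]
  simp only [Matrix.trace_add, Matrix.trace_sub, Matrix.trace_one, Fintype.card_fin]
  push_cast
  ring

/-- **Euclidean distance to planar rotations.**
min_{R ∈ SO(2)} ‖RᵀF − 𝟙‖² = ‖U(F) − 𝟙‖² = ‖F‖² − 2·√(‖F‖² + 2 det F) + 2. -/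
theorem dist_to_SO2 (F : Matrix (Fin 2) (Fin 2) ℝ) (hF : 0 < F.det)
    (U : Matrix (Fin 2) (Fin 2) ℝ) (hUpos : U.PosDef) (hUsq : U * U = Fᵀ * F) :
    IsLeast ((fun R => frobSq (Rᵀ * F - 1)) '' SO 2) (frobSq (U - 1)) ∧
    frobSq (U - 1) = frobSq F - 2 * Real.sqrt (frobSq F + 2 * F.det) + 2 := by
  have hU := frobSq_sub_one_of_mul_self_eq hF hUpos hUsq
  refine ⟨?_, hU⟩
  rw [hU, frobSq_add_two_mul_det]
  have hpos : 0 < (F 0 0 + F 1 1) ^ 2 + (F 1 0 - F 0 1) ^ 2 := by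
    rw [← frobSq_add_two_mul_det, frobSq_fin_two]
    positivity
  set p := F 0 0 + F 1 1
  set q := F 1 0 - F 0 1
  have hs : 0 < √(p ^ 2 + q ^ 2) := Real.sqrt_pos.2 hpos
  have hs2 : √(p ^ 2 + q ^ 2) ^ 2 = p ^ 2 + q ^ 2 := Real.sq_sqrt hpos.le
  set s := √(p ^ 2 + q ^ 2)
  constructor
  · have hR : !![p / s, -(q / s); q / s, p / s] ∈ SO 2 := by
      rw [mem_SO_two_iff]
      refine ⟨rfl, rfl, ?_⟩
      change (p / s) ^ 2 + (q / s) ^ 2 = 1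
      field_simp
      exact hs2.symm
    refine ⟨_, hR, ?_⟩
    have h : p / s * p + q / s * q = s := by
      field_simp
      exact hs2.symm
    refine (frobSq_transpose_mul_sub_one hR F).trans ?_
    change frobSq F - 2 * (p / s * p + q / s * q) + 2 = _
    rw [h]
  · rintro _ ⟨R, hR, rfl⟩
    have h3 := ((mem_SO_two_iff R).1 hR).2.2
    have hle : R 0 0 * p + R 1 0 * q ≤ s := by
      refine Real.le_sqrt_of_sq_le ?_
      linear_combination (p ^ 2 + q ^ 2) * h3 + sq_nonneg (R 0 0 * q - R 1 0 * p)
    change _ ≤ frobSq (Rᵀ * F - 1)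
    rw [frobSq_transpose_mul_sub_one hR F]
    linarith
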